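/- arXiv:2003.04282 — 4 statements merged into one kernel-verified Lean document; each statement's English description precedes it below -/
import Mathlib

section
/- For every integer n ≥ 3, sat*(n, ⋈) ≤ 6n − 10, where ⋈ is the butterfly poset: the poset on four elements a₁, a₂, b₁, b₂ in which a₁ and a₂ are incomparable, b₁ and b₂ are incomparable, and aᵢ < bⱼ for all i, j ∈ {1,2}. -/
/-- The family `F ⊆ 2^[n]` contains an induced (strong) copy of the poset `P`:
there is an injection `f : P → 2^[n]` with image in `F` such that `p ≤ q`
holds if and only if `f p ⊆ f q`. -/
def ContainsIndCopy (P : Type*) [PartialOrder P] {n : ℕ}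
    (F : Finset (Finset (Fin n))) : Prop :=
  ∃ f : P → Finset (Fin n), Function.Injective f ∧ (∀ p, f p ∈ F) ∧
    ∀ p q : P, p ≤ q ↔ f p ⊆ f q

/-- `F` is induced `P`-saturating: it is induced `P`-free and adding any set
outside of `F` creates an induced copy of `P`. -/
def IndSaturating (P : Type*) [PartialOrder P] {n : ℕ}
    (F : Finset (Finset (Fin n))) : Prop :=
  ¬ ContainsIndCopy P F ∧
    ∀ G : Finset (Fin n), G ∉ F → ContainsIndCopy P (insert G F)

/-- `sat*(n,P)`: the minimum size of an induced `P`-saturating family in `2^[n]`. -/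
noncomputable def satStar (n : ℕ) (P : Type*) [PartialOrder P] : ℕ :=
  sInf {m | ∃ F : Finset (Finset (Fin n)), IndSaturating P F ∧ F.card = m}

/-- The underlying type of the butterfly poset `⋈`: two bottom elements and two
top elements. -/
def Butterfly : Type := Fin 2 ⊕ Fin 2

/-- The order of the butterfly poset: the two bottoms are incomparable, the two
tops are incomparable, and every bottom is below every top. -/
def butterflyLE : Butterfly → Butterfly → Prop
  | Sum.inl a, Sum.inl b => a = b
  | Sum.inl _, Sum.inr _ => True
  | Sum.inr _, Sum.inl _ => False
  | Sum.inr a, Sum.inr b => a = b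

instance : PartialOrder Butterfly where
  le := butterflyLE
  le_refl x := by cases x <;> simp [butterflyLE]
  le_trans x y z hxy hyz := by
    cases x <;> cases y <;> cases z <;> simp_all [butterflyLE]
  le_antisymm x y hxy hyx := by
    cases x <;> cases y <;> simp_all [butterflyLE] <;> (subst hxy; rfl)

set_option linter.unusedSimpArgs false

def bfDown {n : ℕ} (S : Finset (Fin n)) : Prop :=
  ∀ i j : Fin n, 2 ≤ i.val → i ≤ j → j ∈ S → i ∈ S

def bfUp {n : ℕ} (S : Finset (Fin n)) : Prop :=
  ∀ i j : Fin n, 2 ≤ i.val → i ≤ j → i ∈ S → j ∈ S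

def bfIn {n : ℕ} (o l : Fin n) (S : Finset (Fin n)) : Prop :=
  (¬ (o ∈ S ∧ l ∈ S) ∧ bfDown S) ∨ ((o ∈ S ∨ l ∈ S) ∧ bfUp S)

theorem bf_mk {n : ℕ} {F : Finset (Finset (Fin n))} (a1 a2 b1 b2 : Finset (Fin n))
    (ha1 : a1 ∈ F) (ha2 : a2 ∈ F) (hb1 : b1 ∈ F) (hb2 : b2 ∈ F)
    (h1 : ¬ a1 ⊆ a2) (h2 : ¬ a2 ⊆ a1) (h3 : ¬ b1 ⊆ b2) (h4 : ¬ b2 ⊆ b1)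
    (h11 : a1 ⊆ b1) (h12 : a1 ⊆ b2) (h21 : a2 ⊆ b1) (h22 : a2 ⊆ b2) :
    ContainsIndCopy Butterfly F := by
  have e1 : ¬ b1 ⊆ a1 := fun h => h3 (h.trans h12)
  have e2 : ¬ b1 ⊆ a2 := fun h => h3 (h.trans h22)
  have e3 : ¬ b2 ⊆ a1 := fun h => h4 (h.trans h11)
  have e4 : ¬ b2 ⊆ a2 := fun h => h4 (h.trans h21)
  have key : ∀ p q : Butterfly, p ≤ q ↔
      (Sum.elim ![a1, a2] ![b1, b2] : Fin 2 ⊕ Fin 2 → Finset (Fin n)) p ⊆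
      (Sum.elim ![a1, a2] ![b1, b2] : Fin 2 ⊕ Fin 2 → Finset (Fin n)) q := by
    intro p q
    change butterflyLE p q ↔ _
    rcases p with p | p <;> rcases q with q | q <;> fin_cases p <;> fin_cases q <;>
      simp [butterflyLE, *]
  refine ⟨(Sum.elim ![a1, a2] ![b1, b2] : Fin 2 ⊕ Fin 2 → Finset (Fin n)), ?_, ?_, key⟩
  · intro p q h
    exact le_antisymm ((key p q).2 (by rw [h])) ((key q p).2 (by rw [h]))
  · intro p
    rcases p with p | p <;> fin_cases p <;> simp [*]

theorem bf_claim {n : ℕ} (o l t : Fin n) (ho : o.val = 0) (hl : l.val = 1) (ht : t.val = 2)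
    (S T : Finset (Fin n)) (hS : bfIn o l S) (hT : bfIn o l T)
    (h1 : ¬ S ⊆ T) (h2 : ¬ T ⊆ S) :
    ((o ∈ S ∨ o ∈ T) ∧ (l ∈ S ∨ l ∈ T)) ∨
      ((t ∈ S ∨ t ∈ T) ∧ (o ∈ S ∨ o ∈ T ∨ l ∈ S ∨ l ∈ T)) := by
  obtain ⟨x, hx, hx'⟩ := Finset.not_subset.1 h1
  obtain ⟨y, hy, hy'⟩ := Finset.not_subset.1 h2
  have tri : ∀ z : Fin n, z = o ∨ z = l ∨ (2 ≤ z.val ∧ t ≤ z) := by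
    intro z
    simp only [Fin.ext_iff, Fin.le_def]
    omega
  have t2 : 2 ≤ t.val := by omega
  have tx := tri x
  have ty := tri y
  have xy := le_total x y
  unfold bfIn at hS hT
  rcases hS with ⟨a, hS⟩ | ⟨a, hS⟩ <;> rcases hT with ⟨b, hT⟩ | ⟨b, hT⟩
  · have := hS t x t2
    have := hT t y t2
    have := hS x y
    have := hT x y
    have := hS y x
    have := hT y x
    grind
  · have := hS t x t2
    grind
  · have := hT t y t2
    grind
  · have := hS x y
    have := hT x y
    have := hS y x
    have := hT y x
    grind

theorem bf_compl {n : ℕ} (o l : Fin n) (S : Finset (Fin n)) (h : bfIn o l S) :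
    bfIn o l Sᶜ := by
  unfold bfIn bfUp bfDown at *
  simp only [Finset.mem_compl]
  rcases h with ⟨a, h⟩ | ⟨a, h⟩
  · right
    exact ⟨by tauto, fun i j hi hij h1 h2 => h1 (h i j hi hij h2)⟩
  · left
    exact ⟨by tauto, fun i j hi hij h1 h2 => h1 (h i j hi hij h2)⟩

theorem bf_free_aux {n : ℕ} (o l t : Fin n) (ho : o.val = 0) (hl : l.val = 1) (ht : t.val = 2)
    (a1 a2 b1 b2 : Finset (Fin n))
    (ha1 : bfIn o l a1) (ha2 : bfIn o l a2) (hb1 : bfIn o l b1) (hb2 : bfIn o l b2)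
    (n1 : ¬ a1 ⊆ a2) (n2 : ¬ a2 ⊆ a1) (n3 : ¬ b1 ⊆ b2) (n4 : ¬ b2 ⊆ b1)
    (h1 : a1 ⊆ b1) (h2 : a1 ⊆ b2) (h3 : a2 ⊆ b1) (h4 : a2 ⊆ b2) : False := by
  have hA := bf_claim o l t ho hl ht a1 a2 ha1 ha2 n1 n2
  have hB := bf_claim o l t ho hl ht b1ᶜ b2ᶜ (bf_compl _ _ _ hb1) (bf_compl _ _ _ hb2)
    (by rwa [Finset.compl_subset_compl]) (by rwa [Finset.compl_subset_compl])
  simp only [Finset.mem_compl] at hB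
  have ho1 := @h1 o
  have ho2 := @h2 o
  have ho3 := @h3 o
  have ho4 := @h4 o
  have hl1 := @h1 l
  have hl2 := @h2 l
  have hl3 := @h3 l
  have hl4 := @h4 l
  have ht1 := @h1 t
  have ht2 := @h2 t
  have ht3 := @h3 t
  have ht4 := @h4 t
  clear h1 h2 h3 h4 n1 n2 n3 n4 ha1 ha2 hb1 hb2
  grind

theorem bf_free {n : ℕ} (o l t : Fin n) (ho : o.val = 0) (hl : l.val = 1) (ht : t.val = 2)
    (F : Finset (Finset (Fin n))) (hF : ∀ S ∈ F, bfIn o l S) :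
    ¬ ContainsIndCopy Butterfly F := by
  rintro ⟨f, -, hf, h⟩
  have n1 : ¬ f (Sum.inl 0) ⊆ f (Sum.inl 1) := fun hh =>
    absurd (show (0 : Fin 2) = 1 from (h _ _).2 hh) (by decide)
  have n2 : ¬ f (Sum.inl 1) ⊆ f (Sum.inl 0) := fun hh =>
    absurd (show (1 : Fin 2) = 0 from (h _ _).2 hh) (by decide)
  have n3 : ¬ f (Sum.inr 0) ⊆ f (Sum.inr 1) := fun hh =>
    absurd (show (0 : Fin 2) = 1 from (h _ _).2 hh) (by decide)
  have n4 : ¬ f (Sum.inr 1) ⊆ f (Sum.inr 0) := fun hh =>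
    absurd (show (1 : Fin 2) = 0 from (h _ _).2 hh) (by decide)
  exact bf_free_aux o l t ho hl ht _ _ _ _ (hF _ (hf _)) (hF _ (hf _)) (hF _ (hf _))
    (hF _ (hf _)) n1 n2 n3 n4 ((h (Sum.inl 0) (Sum.inr 0)).1 trivial)
    ((h (Sum.inl 0) (Sum.inr 1)).1 trivial) ((h (Sum.inl 1) (Sum.inr 0)).1 trivial)
    ((h (Sum.inl 1) (Sum.inr 1)).1 trivial)

theorem bf_mixed {n : ℕ} (p q t : Fin n) (hpq : p.val + q.val = 1) (ht : t.val = 2)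
    (F : Finset (Finset (Fin n))) (hF : ∀ S, bfIn p q S → S ∈ F)
    (G : Finset (Fin n)) (hG : ¬ bfIn p q G) (hp : p ∈ G) (hq : q ∉ G) :
    ContainsIndCopy Butterfly (insert G F) := by
  have hF' : ∀ S, bfIn p q S → S ∈ insert G F := fun S h => Finset.mem_insert_of_mem (hF S h)
  have hd : ¬ bfDown G := fun h => hG (Or.inl ⟨by tauto, h⟩)
  have hu : ¬ bfUp G := fun h => hG (Or.inr ⟨by tauto, h⟩)
  have hne : p ≠ q := by rintro rfl; omega
  by_cases h2 : t ∈ G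
  · unfold bfDown at hd
    push Not at hd
    obtain ⟨i, j, hi, hij, hj, hiG⟩ := hd
    have hij' : i ≠ j := by rintro rfl; exact hiG hj
    refine bf_mk {t} {p} G (Finset.univ.filter fun k => k = p ∨ (2 ≤ k.val ∧ k ≤ i))
      (hF' _ ?_) (hF' _ ?_) (Finset.mem_insert_self _ _) (hF' _ ?_) ?_ ?_ ?_ ?_ ?_ ?_ ?_ ?_
    · refine Or.inl ⟨?_, fun x y => ?_⟩ <;> simp only [Finset.mem_filter, Finset.mem_univ, Finset.mem_singleton, true_and,
        Finset.singleton_subset_iff, Fin.le_def, Fin.ext_iff, ne_eq, true_or, or_true,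
        not_true_eq_false, false_and, and_false, not_false_eq_true] <;> omega
    · refine Or.inl ⟨?_, fun x y => ?_⟩ <;> simp only [Finset.mem_filter, Finset.mem_univ, Finset.mem_singleton, true_and,
        Finset.singleton_subset_iff, Fin.le_def, Fin.ext_iff, ne_eq, true_or, or_true,
        not_true_eq_false, false_and, and_false, not_false_eq_true] <;> omega
    · refine Or.inl ⟨?_, fun x y => ?_⟩ <;> simp only [Finset.mem_filter, Finset.mem_univ, Finset.mem_singleton, true_and,
        Finset.singleton_subset_iff, Fin.le_def, Fin.ext_iff, ne_eq, true_or, or_true,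
        not_true_eq_false, false_and, and_false, not_false_eq_true] <;> omega
    · simp only [Finset.mem_filter, Finset.mem_univ, Finset.mem_singleton, true_and,
        Finset.singleton_subset_iff, Fin.le_def, Fin.ext_iff, ne_eq, true_or, or_true,
        not_true_eq_false, false_and, and_false, not_false_eq_true]; omega
    · simp only [Finset.mem_filter, Finset.mem_univ, Finset.mem_singleton, true_and,
        Finset.singleton_subset_iff, Fin.le_def, Fin.ext_iff, ne_eq, true_or, or_true,
        not_true_eq_false, false_and, and_false, not_false_eq_true]; omega
    · intro h; have := h hj; simp only [Finset.mem_filter, Finset.mem_univ, Finset.mem_singleton, true_and,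
        Finset.singleton_subset_iff, Fin.le_def, Fin.ext_iff, ne_eq, true_or, or_true,
        not_true_eq_false, false_and, and_false, not_false_eq_true] at this hij hij'; omega
    · intro h; exact hiG (h (by simp [hi]))
    · simpa using h2
    · simp only [Finset.mem_filter, Finset.mem_univ, Finset.mem_singleton, true_and,
        Finset.singleton_subset_iff, Fin.le_def, Fin.ext_iff, ne_eq, true_or, or_true,
        not_true_eq_false, false_and, and_false, not_false_eq_true]; omega
    · simpa using hp
    · simp
  · unfold bfUp at hu
    push Not at hu
    obtain ⟨i, j, hi, hij, hiG, hj⟩ := hu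
    have hij' : i ≠ j := by rintro rfl; exact hj hiG
    have hti : t ≠ i := by rintro rfl; exact h2 hiG
    refine bf_mk G (Finset.univ.filter fun k => k = p ∨ j ≤ k)
      (Finset.univ.filter fun k => k ≠ q) (Finset.univ.filter fun k => k ≠ t)
      (Finset.mem_insert_self _ _) (hF' _ ?_) (hF' _ ?_) (hF' _ ?_) ?_ ?_ ?_ ?_ ?_ ?_ ?_ ?_
    · refine Or.inr ⟨?_, fun x y => ?_⟩ <;> simp only [Finset.mem_filter, Finset.mem_univ, Finset.mem_singleton, true_and,
        Finset.singleton_subset_iff, Fin.le_def, Fin.ext_iff, ne_eq, true_or, or_true,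
        not_true_eq_false, false_and, and_false, not_false_eq_true] <;> omega
    · refine Or.inr ⟨?_, fun x y => ?_⟩ <;> simp only [Finset.mem_filter, Finset.mem_univ, Finset.mem_singleton, true_and,
        Finset.singleton_subset_iff, Fin.le_def, Fin.ext_iff, ne_eq, true_or, or_true,
        not_true_eq_false, false_and, and_false, not_false_eq_true] <;> omega
    · refine Or.inr ⟨?_, fun x y => ?_⟩ <;> simp only [Finset.mem_filter, Finset.mem_univ, Finset.mem_singleton, true_and,
        Finset.singleton_subset_iff, Fin.le_def, Fin.ext_iff, ne_eq, true_or, or_true,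
        not_true_eq_false, false_and, and_false, not_false_eq_true] <;> omega
    · intro h; have := h hiG; simp only [Finset.mem_filter, Finset.mem_univ, Finset.mem_singleton, true_and,
        Finset.singleton_subset_iff, Fin.le_def, Fin.ext_iff, ne_eq, true_or, or_true,
        not_true_eq_false, false_and, and_false, not_false_eq_true] at this hij hij'; omega
    · intro h; exact hj (h (by simp))
    · intro h
      have := @h t (by simp only [Finset.mem_filter, Finset.mem_univ, Finset.mem_singleton, true_and,
        Finset.singleton_subset_iff, Fin.le_def, Fin.ext_iff, ne_eq, true_or, or_true,
        not_true_eq_false, false_and, and_false, not_false_eq_true]; omega)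
      simp at this
    · intro h
      have := @h q (by simp only [Finset.mem_filter, Finset.mem_univ, Finset.mem_singleton, true_and,
        Finset.singleton_subset_iff, Fin.le_def, Fin.ext_iff, ne_eq, true_or, or_true,
        not_true_eq_false, false_and, and_false, not_false_eq_true]; omega)
      simp at this
    · intro k hk; simp; rintro rfl; exact hq hk
    · intro k hk; simp; rintro rfl; exact h2 hk
    · intro k; simp only [Finset.mem_filter, Finset.mem_univ, Finset.mem_singleton, true_and,
        Finset.singleton_subset_iff, Fin.le_def, Fin.ext_iff, ne_eq, true_or, or_true,
        not_true_eq_false, false_and, and_false, not_false_eq_true] at *; omega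
    · intro k; simp only [Finset.mem_filter, Finset.mem_univ, Finset.mem_singleton, true_and,
        Finset.singleton_subset_iff, Fin.le_def, Fin.ext_iff, ne_eq, true_or, or_true,
        not_true_eq_false, false_and, and_false, not_false_eq_true] at *; omega

theorem bf_sat {n : ℕ} (o l t : Fin n) (ho : o.val = 0) (hl : l.val = 1) (ht : t.val = 2)
    (F : Finset (Finset (Fin n))) (hF : ∀ S, bfIn o l S → S ∈ F)
    (G : Finset (Fin n)) (hG : G ∉ F) :
    ContainsIndCopy Butterfly (insert G F) := by
  have hG' : ¬ bfIn o l G := fun h => hG (hF _ h)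
  have hF' : ∀ S, bfIn o l S → S ∈ insert G F := fun S h => Finset.mem_insert_of_mem (hF S h)
  have hsw : ∀ S, bfIn l o S ↔ bfIn o l S := by intro S; unfold bfIn; tauto
  by_cases h0 : o ∈ G <;> by_cases h1 : l ∈ G
  · have hu : ¬ bfUp G := fun h => hG' (Or.inr ⟨by tauto, h⟩)
    unfold bfUp at hu
    push Not at hu
    obtain ⟨i, j, hi, hij, hiG, hj⟩ := hu
    have hij' : i ≠ j := by rintro rfl; exact hj hiG
    refine bf_mk {o} {l} G (Finset.univ.filter fun k => k = o ∨ k = l ∨ j ≤ k)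
      (hF' _ ?_) (hF' _ ?_) (Finset.mem_insert_self _ _) (hF' _ ?_) ?_ ?_ ?_ ?_ ?_ ?_ ?_ ?_
    · refine Or.inl ⟨?_, fun x y => ?_⟩ <;> simp only [Finset.mem_filter, Finset.mem_univ, Finset.mem_singleton, true_and,
        Finset.singleton_subset_iff, Fin.le_def, Fin.ext_iff, ne_eq, true_or, or_true,
        not_true_eq_false, false_and, and_false, not_false_eq_true] <;> omega
    · refine Or.inl ⟨?_, fun x y => ?_⟩ <;> simp only [Finset.mem_filter, Finset.mem_univ, Finset.mem_singleton, true_and,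
        Finset.singleton_subset_iff, Fin.le_def, Fin.ext_iff, ne_eq, true_or, or_true,
        not_true_eq_false, false_and, and_false, not_false_eq_true] <;> omega
    · refine Or.inr ⟨?_, fun x y => ?_⟩ <;> simp only [Finset.mem_filter, Finset.mem_univ, Finset.mem_singleton, true_and,
        Finset.singleton_subset_iff, Fin.le_def, Fin.ext_iff, ne_eq, true_or, or_true,
        not_true_eq_false, false_and, and_false, not_false_eq_true] <;> omega
    · simp only [Finset.mem_filter, Finset.mem_univ, Finset.mem_singleton, true_and,
        Finset.singleton_subset_iff, Fin.le_def, Fin.ext_iff, ne_eq, true_or, or_true,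
        not_true_eq_false, false_and, and_false, not_false_eq_true]; omega
    · simp only [Finset.mem_filter, Finset.mem_univ, Finset.mem_singleton, true_and,
        Finset.singleton_subset_iff, Fin.le_def, Fin.ext_iff, ne_eq, true_or, or_true,
        not_true_eq_false, false_and, and_false, not_false_eq_true]; omega
    · intro h; have := h hiG; simp only [Finset.mem_filter, Finset.mem_univ, Finset.mem_singleton, true_and,
        Finset.singleton_subset_iff, Fin.le_def, Fin.ext_iff, ne_eq, true_or, or_true,
        not_true_eq_false, false_and, and_false, not_false_eq_true] at this hij hij'; omega
    · intro h; exact hj (h (by simp))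
    · simpa using h0
    · simp
    · simpa using h1
    · simp
  · exact bf_mixed o l t (by omega) ht F hF G hG' h0 h1
  · exact bf_mixed l o t (by omega) ht F (fun S h => hF S ((hsw S).1 h)) G
      (fun h => hG' ((hsw G).1 h)) h1 h0
  · have hd : ¬ bfDown G := fun h => hG' (Or.inl ⟨by tauto, h⟩)
    unfold bfDown at hd
    push Not at hd
    obtain ⟨i, j, hi, hij, hj, hiG⟩ := hd
    have hij' : i ≠ j := by rintro rfl; exact hiG hj
    refine bf_mk G (Finset.univ.filter fun k => 2 ≤ k.val ∧ k ≤ i)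
      (Finset.univ.filter fun k => k ≠ o) (Finset.univ.filter fun k => k ≠ l)
      (Finset.mem_insert_self _ _) (hF' _ ?_) (hF' _ ?_) (hF' _ ?_) ?_ ?_ ?_ ?_ ?_ ?_ ?_ ?_
    · refine Or.inl ⟨?_, fun x y => ?_⟩ <;> simp only [Finset.mem_filter, Finset.mem_univ, Finset.mem_singleton, true_and,
        Finset.singleton_subset_iff, Fin.le_def, Fin.ext_iff, ne_eq, true_or, or_true,
        not_true_eq_false, false_and, and_false, not_false_eq_true] <;> omega
    · refine Or.inl ⟨?_, fun x y => ?_⟩ <;> simp only [Finset.mem_filter, Finset.mem_univ, Finset.mem_singleton, true_and,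
        Finset.singleton_subset_iff, Fin.le_def, Fin.ext_iff, ne_eq, true_or, or_true,
        not_true_eq_false, false_and, and_false, not_false_eq_true] <;> omega
    · refine Or.inl ⟨?_, fun x y => ?_⟩ <;> simp only [Finset.mem_filter, Finset.mem_univ, Finset.mem_singleton, true_and,
        Finset.singleton_subset_iff, Fin.le_def, Fin.ext_iff, ne_eq, true_or, or_true,
        not_true_eq_false, false_and, and_false, not_false_eq_true] <;> omega
    · intro h; have := h hj; simp only [Finset.mem_filter, Finset.mem_univ, Finset.mem_singleton, true_and,
        Finset.singleton_subset_iff, Fin.le_def, Fin.ext_iff, ne_eq, true_or, or_true,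
        not_true_eq_false, false_and, and_false, not_false_eq_true] at this hij hij'; omega
    · intro h; exact hiG (h (by simp [hi]))
    · intro h
      have := @h l (by simp only [Finset.mem_filter, Finset.mem_univ, Finset.mem_singleton, true_and,
        Finset.singleton_subset_iff, Fin.le_def, Fin.ext_iff, ne_eq, true_or, or_true,
        not_true_eq_false, false_and, and_false, not_false_eq_true]; omega)
      simp at this
    · intro h
      have := @h o (by simp only [Finset.mem_filter, Finset.mem_univ, Finset.mem_singleton, true_and,
        Finset.singleton_subset_iff, Fin.le_def, Fin.ext_iff, ne_eq, true_or, or_true,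
        not_true_eq_false, false_and, and_false, not_false_eq_true]; omega)
      simp at this
    · intro k hk; simp; rintro rfl; exact h0 hk
    · intro k hk; simp; rintro rfl; exact h1 hk
    · intro k; simp only [Finset.mem_filter, Finset.mem_univ, Finset.mem_singleton, true_and,
        Finset.singleton_subset_iff, Fin.le_def, Fin.ext_iff, ne_eq, true_or, or_true,
        not_true_eq_false, false_and, and_false, not_false_eq_true] at *; omega
    · intro k; simp only [Finset.mem_filter, Finset.mem_univ, Finset.mem_singleton, true_and,
        Finset.singleton_subset_iff, Fin.le_def, Fin.ext_iff, ne_eq, true_or, or_true,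
        not_true_eq_false, false_and, and_false, not_false_eq_true] at *; omega

/-- Initial segments of the tail, with prefix `A`. -/
def bfD {n : ℕ} (A : Finset (Fin n)) (k : ℕ) : Finset (Fin n) :=
  Finset.univ.filter fun i => i ∈ A ∨ (2 ≤ i.val ∧ i.val < k)

/-- Final segments of the tail, with prefix `A`. -/
def bfE {n : ℕ} (A : Finset (Fin n)) (k : ℕ) : Finset (Fin n) :=
  Finset.univ.filter fun i => i ∈ A ∨ (2 ≤ i.val ∧ k ≤ i.val)

/-- A threshold for sets that are initial segments on the tail. -/
theorem bf_thr {n : ℕ} (hn : 3 ≤ n) (Q : Fin n → Prop)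
    (h : ∀ i j : Fin n, 2 ≤ i.val → i ≤ j → Q j → Q i) :
    ∃ k, 2 ≤ k ∧ k ≤ n ∧ ∀ i : Fin n, 2 ≤ i.val → (Q i ↔ i.val < k) := by
  classical
  by_cases hall : ∀ i : Fin n, 2 ≤ i.val → Q i
  · exact ⟨n, by omega, le_rfl, fun i hi => ⟨fun _ => i.2, fun _ => hall i hi⟩⟩
  · push Not at hall
    have hex : ∃ k, 2 ≤ k ∧ ∃ hk : k < n, ¬ Q ⟨k, hk⟩ := by
      obtain ⟨i, hi, hq⟩ := hall
      exact ⟨i.val, hi, i.2, hq⟩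
    obtain ⟨h2, hk, hq⟩ := Nat.find_spec hex
    refine ⟨Nat.find hex, h2, hk.le, fun i hi => ⟨fun hQ => ?_, fun hlt => ?_⟩⟩
    · by_contra hc
      exact hq (h ⟨_, hk⟩ i h2 (by simp only [Fin.le_def]; omega) hQ)
    · by_contra hc
      exact Nat.find_min hex hlt ⟨hi, i.2, hc⟩

theorem bf_cover {n : ℕ} (hn : 3 ≤ n) (o l : Fin n) (ho : o.val = 0) (hl : l.val = 1)
    (S : Finset (Fin n)) (h : bfIn o l S) :
    S ∈ (((Finset.Icc 2 n).image (bfD ∅) ∪ (Finset.Icc 2 n).image (bfE {o, l})) ∪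
      ((Finset.Icc 3 n).image (bfD {o}) ∪ (Finset.Icc 3 n).image (bfE {o}))) ∪
      ((Finset.Icc 3 n).image (bfD {l}) ∪ (Finset.Icc 3 n).image (bfE {l})) := by
  have tri : ∀ z : Fin n, z = o ∨ z = l ∨ (2 ≤ z.val ∧ z ≠ o ∧ z ≠ l) := by
    intro z
    simp only [Fin.ext_iff, ne_eq, true_or, or_true,
        not_true_eq_false, false_and, and_false, not_false_eq_true]
    omega
  have hol : o ≠ l := by simp only [ne_eq, Fin.ext_iff]; omega
  simp only [Finset.mem_union, Finset.mem_image, Finset.mem_Icc]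
  have eD : ∀ (A : Finset (Fin n)) (k : ℕ), (∀ i : Fin n, 2 ≤ i.val → (i ∈ S ↔ i.val < k)) →
      A ⊆ {o, l} → (o ∈ S ↔ o ∈ A) → (l ∈ S ↔ l ∈ A) → bfD A k = S := by
    intro A k hk hA h0 h1
    ext z
    simp only [bfD, Finset.mem_filter, Finset.mem_univ, true_and]
    rcases tri z with rfl | rfl | ⟨hz, hz1, hz2⟩
    · rw [h0]; simp [ho]
    · rw [h1]; simp [hl]
    · rw [hk z hz]
      have : z ∉ A := fun hh => by have := hA hh; simp [hz1, hz2] at this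
      simp [this, hz]
  have eE : ∀ (A : Finset (Fin n)) (k : ℕ), (∀ i : Fin n, 2 ≤ i.val → (i ∈ S ↔ k ≤ i.val)) →
      A ⊆ {o, l} → (o ∈ S ↔ o ∈ A) → (l ∈ S ↔ l ∈ A) → bfE A k = S := by
    intro A k hk hA h0 h1
    ext z
    simp only [bfE, Finset.mem_filter, Finset.mem_univ, true_and]
    rcases tri z with rfl | rfl | ⟨hz, hz1, hz2⟩
    · rw [h0]; simp [ho]
    · rw [h1]; simp [hl]
    · rw [hk z hz]
      have : z ∉ A := fun hh => by have := hA hh; simp [hz1, hz2] at this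
      simp [this, hz]
  have s1 : ({o} : Finset (Fin n)) ⊆ {o, l} := by simp
  have s2 : ({l} : Finset (Fin n)) ⊆ {o, l} := by simp
  rcases h with ⟨a, h⟩ | ⟨a, h⟩
  · obtain ⟨k, hk2, hkn, hk⟩ := bf_thr hn (fun i => i ∈ S) h
    by_cases h0 : o ∈ S
    · have h1 : l ∉ S := fun hh => a ⟨h0, hh⟩
      left; right
      by_cases hk3 : 3 ≤ k
      · exact Or.inl ⟨k, ⟨hk3, hkn⟩, eD _ k hk s1 (by simp [h0]) (by simp [h1, hol.symm])⟩
      · refine Or.inr ⟨n, ⟨hn, le_rfl⟩, eE _ n (fun i hi => ?_) s1 (by simp [h0])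
          (by simp [h1, hol.symm])⟩
        rw [hk i hi]
        omega
    · by_cases h1 : l ∈ S
      · right
        by_cases hk3 : 3 ≤ k
        · exact Or.inl ⟨k, ⟨hk3, hkn⟩, eD _ k hk s2 (by simp [h0, hol]) (by simp [h1])⟩
        · refine Or.inr ⟨n, ⟨hn, le_rfl⟩, eE _ n (fun i hi => ?_) s2 (by simp [h0, hol])
            (by simp [h1])⟩
          rw [hk i hi]
          omega
      · left; left; left
        exact ⟨k, ⟨hk2, hkn⟩, eD _ k hk (by simp) (by simp [h0]) (by simp [h1])⟩
  · obtain ⟨k, hk2, hkn, hk⟩ := bf_thr hn (fun i => i ∉ S)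
      (fun i j hi hij hj hh => hj (h i j hi hij hh))
    have hk' : ∀ i : Fin n, 2 ≤ i.val → (i ∈ S ↔ k ≤ i.val) := by
      intro i hi
      have := hk i hi
      rw [← not_iff_not, this]
      omega
    by_cases h0 : o ∈ S
    · by_cases h1 : l ∈ S
      · left; left; right
        exact ⟨k, ⟨hk2, hkn⟩, eE _ k hk' (by simp) (by simp [h0]) (by simp [h1])⟩
      · left; right
        by_cases hk3 : 3 ≤ k
        · exact Or.inr ⟨k, ⟨hk3, hkn⟩, eE _ k hk' s1 (by simp [h0]) (by simp [h1, hol.symm])⟩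
        · refine Or.inl ⟨n, ⟨hn, le_rfl⟩, eD _ n (fun i hi => ?_) s1 (by simp [h0])
            (by simp [h1, hol.symm])⟩
          rw [hk' i hi]
          omega
    · have h1 : l ∈ S := by tauto
      right
      by_cases hk3 : 3 ≤ k
      · exact Or.inr ⟨k, ⟨hk3, hkn⟩, eE _ k hk' s2 (by simp [h0, hol]) (by simp [h1])⟩
      · refine Or.inl ⟨n, ⟨hn, le_rfl⟩, eD _ n (fun i hi => ?_) s2 (by simp [h0, hol])
          (by simp [h1])⟩
        rw [hk' i hi]
        omega

/-- For every `n ≥ 3`, the induced saturation number of the butterfly poset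
satisfies `sat*(n, ⋈) ≤ 6n - 10`. -/
theorem satStar_butterfly_le (n : ℕ) (hn : 3 ≤ n) :
    satStar n Butterfly ≤ 6 * n - 10 := by
  classical
  let o : Fin n := ⟨0, by omega⟩
  let l : Fin n := ⟨1, by omega⟩
  let t : Fin n := ⟨2, by omega⟩
  let F : Finset (Finset (Fin n)) := Finset.univ.filter fun S => bfIn o l S
  have hF : ∀ S, S ∈ F ↔ bfIn o l S := by intro S; simp [F]
  have hsat : IndSaturating Butterfly F :=
    ⟨bf_free o l t rfl rfl rfl F (fun S h => (hF S).1 h),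
      fun G hG => bf_sat o l t rfl rfl rfl F (fun S h => (hF S).2 h) G hG⟩
  have h1 : satStar n Butterfly ≤ F.card := Nat.sInf_le ⟨F, hsat, rfl⟩
  have h2 := Finset.card_le_card (fun S hS => bf_cover hn o l rfl rfl S ((hF S).1 hS) :
    F ⊆ _)
  have c2 : ∀ f : ℕ → Finset (Fin n), ((Finset.Icc 2 n).image f).card ≤ n - 1 := by
    intro f
    refine Finset.card_image_le.trans ?_
    simp
  have c3 : ∀ f : ℕ → Finset (Fin n), ((Finset.Icc 3 n).image f).card ≤ n - 2 := by
    intro f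
    refine Finset.card_image_le.trans ?_
    simp
  refine h1.trans (h2.trans ?_)
  refine (Finset.card_union_le _ _).trans ?_
  refine (Nat.add_le_add (Finset.card_union_le _ _) (Finset.card_union_le _ _)).trans ?_
  refine (Nat.add_le_add_right
    (Nat.add_le_add (Finset.card_union_le _ _) (Finset.card_union_le _ _)) _).trans ?_
  have := c2 (bfD ∅)
  have := c2 (bfE {o, l})
  have := c3 (bfD {o})
  have := c3 (bfE {o})
  have := c3 (bfD {l})
  have := c3 (bfE {l})
  omega
end

section
/- For every integer n ≥ 3, sat*(n, 2C₃) ≤ 3n − 1, where 2C₃ is the disjoint union of two incomparable 3-element chains. Moreover, the family ℱ = {∅} ∪ {[j] : 1 ≤ j ≤ n} ∪ {{j} : 1 ≤ j ≤ n} ∪ {[n] \ {j} : 1 ≤ j ≤ n} (a full chain together with all singletons and all complements of singletons) is an induced 2C₃-saturating family in 2^[n]. -/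
/-- The full chain `∅ ⊂ {1} ⊂ {1,2} ⊂ ⋯ ⊂ [n]` of initial segments in `2^[n]`. -/
def fullChain (n : ℕ) : Finset (Finset (Fin n)) :=
  (Finset.range (n + 1)).image (fun j => Finset.univ.filter (fun i : Fin n => (i : ℕ) < j))

/-- The family `{∅} ∪ {[j] : 1 ≤ j ≤ n} ∪ {{j} : 1 ≤ j ≤ n} ∪ {[n] \ {j} : 1 ≤ j ≤ n}`:
a full chain together with all singletons and all complements of singletons. -/
def chainSingletonsCosingletons (n : ℕ) : Finset (Finset (Fin n)) :=
  fullChain n ∪ Finset.univ.image (fun i : Fin n => ({i} : Finset (Fin n)))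
    ∪ Finset.univ.image (fun i : Fin n => (Finset.univ \ {i} : Finset (Fin n)))

/-- `2C₃`, the disjoint union of two incomparable `3`-element chains. -/
abbrev TwoC3 : Type := Fin 3 ⊕ Fin 3

theorem mem_csc {n : ℕ} (G : Finset (Fin n)) : G ∈ chainSingletonsCosingletons n ↔
    (∃ j, j < n + 1 ∧ Finset.univ.filter (fun i : Fin n => (i : ℕ) < j) = G) ∨
    (∃ i, {i} = G) ∨ (∃ i, Finset.univ \ {i} = G) := by
  simp [chainSingletonsCosingletons, fullChain, or_assoc]

theorem copy_mk {n : ℕ} {F : Finset (Finset (Fin n))} {A B C D E H : Finset (Fin n)}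
    (hA : A ∈ F) (hB : B ∈ F) (hC : C ∈ F) (hD : D ∈ F) (hE : E ∈ F) (hH : H ∈ F)
    (hAB : A ⊂ B) (hBC : B ⊂ C) (hDE : D ⊂ E) (hEH : E ⊂ H)
    (h1 : ¬ A ⊆ H) (h2 : ¬ D ⊆ C) : ContainsIndCopy TwoC3 F := by
  have m1 : StrictMono ![A, B, C] := by
    rw [Fin.strictMono_iff_lt_succ]
    intro i; fin_cases i
    · exact hAB
    · exact hBC
  have m2 : StrictMono ![D, E, H] := by
    rw [Fin.strictMono_iff_lt_succ]
    intro i; fin_cases i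
    · exact hDE
    · exact hEH
  have key : ∀ p q : TwoC3, p ≤ q ↔
      (Sum.elim ![A, B, C] ![D, E, H] p : Finset (Fin n)) ⊆ Sum.elim ![A, B, C] ![D, E, H] q := by
    rintro (p | p) (q | q)
    · simpa using m1.le_iff_le.symm
    · simp only [Sum.not_inl_le_inr, Sum.elim_inl, Sum.elim_inr, false_iff]
      intro h
      exact h1 (((m1.monotone (Fin.zero_le p)).trans h).trans (m2.monotone (Fin.le_last q)))
    · simp only [Sum.not_inr_le_inl, Sum.elim_inl, Sum.elim_inr, false_iff]
      intro h
      exact h2 (((m2.monotone (Fin.zero_le p)).trans h).trans (m1.monotone (Fin.le_last q)))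
    · simpa using m2.le_iff_le.symm
  refine ⟨Sum.elim ![A, B, C] ![D, E, H], ?_, ?_, key⟩
  · intro p q h
    exact le_antisymm ((key p q).2 h.le) ((key q p).2 h.ge)
  · rintro (p | p) <;> fin_cases p <;> simpa

theorem mid_chain {n : ℕ} {A B C : Finset (Fin n)} (hB : B ∈ chainSingletonsCosingletons n)
    (hAB : A ⊂ B) (hBC : B ⊂ C) (hA : A ≠ ∅) (hC : C ≠ Finset.univ) :
    ∃ j, Finset.univ.filter (fun i : Fin n => (i : ℕ) < j) = B := by
  rcases (mem_csc B).1 hB with ⟨j, -, h⟩ | ⟨i, rfl⟩ | ⟨i, rfl⟩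
  · exact ⟨j, h⟩
  · exact absurd (Finset.ssubset_singleton_iff.1 hAB) hA
  · exfalso
    obtain ⟨y, hy, hy'⟩ := Finset.exists_of_ssubset hBC
    have : y = i := by simpa using hy'
    subst this
    apply hC
    ext w
    simp only [Finset.mem_univ, iff_true]
    by_cases hw : w = y
    · rw [hw]; exact hy
    · exact hBC.1 (by simp [hw])

theorem csc_free (n : ℕ) : ¬ ContainsIndCopy TwoC3 (chainSingletonsCosingletons n) := by
  rintro ⟨f, hinj, hmem, hf⟩
  have lt : ∀ p q : TwoC3, p < q → f p ⊂ f q := by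
    intro p q h
    exact ⟨(hf p q).1 h.le, fun h' => h.not_ge ((hf q p).2 h')⟩
  have ne0 : ∀ p : TwoC3, f p ≠ ∅ := by
    rintro (p | p) h
    · have := (hf (Sum.inl p) (Sum.inr 0)).2 (by simp [h])
      simp at this
    · have := (hf (Sum.inr p) (Sum.inl 0)).2 (by simp [h])
      simp at this
  have ne1 : ∀ p : TwoC3, f p ≠ Finset.univ := by
    rintro (p | p) h
    · have := (hf (Sum.inr 0) (Sum.inl p)).2 (by simp [h])
      simp at this
    · have := (hf (Sum.inl 0) (Sum.inr p)).2 (by simp [h])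
      simp at this
  obtain ⟨j, hj⟩ := mid_chain (hmem (Sum.inl 1)) (lt (Sum.inl 0) (Sum.inl 1) (by simp))
    (lt (Sum.inl 1) (Sum.inl 2) (by simp)) (ne0 _) (ne1 _)
  obtain ⟨k, hk⟩ := mid_chain (hmem (Sum.inr 1)) (lt (Sum.inr 0) (Sum.inr 1) (by simp))
    (lt (Sum.inr 1) (Sum.inr 2) (by simp)) (ne0 _) (ne1 _)
  rcases le_total j k with h | h
  · have := (hf (Sum.inl 1) (Sum.inr 1)).2 (by
      rw [← hj, ← hk]; intro i; simp only [Finset.mem_filter, Finset.mem_univ, true_and]; omega)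
    simp at this
  · have := (hf (Sum.inr 1) (Sum.inl 1)).2 (by
      rw [← hj, ← hk]; intro i; simp only [Finset.mem_filter, Finset.mem_univ, true_and]; omega)
    simp at this

theorem csc_sat (n : ℕ) (hn : 3 ≤ n) (G : Finset (Fin n))
    (hG : G ∉ chainSingletonsCosingletons n) :
    ContainsIndCopy TwoC3 (insert G (chainSingletonsCosingletons n)) := by
  have hG' := hG
  rw [mem_csc] at hG'
  push Not at hG'
  obtain ⟨hch, hs, hc⟩ := hG'
  have hch' : ∀ j, j < n + 1 → ¬ ∀ i : Fin n, i ∈ G ↔ (i : ℕ) < j := by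
    intro j hj h
    apply hch j hj
    ext i; simp [h i]
  have hs' : ∀ j : Fin n, ¬ ∀ i : Fin n, i ∈ G ↔ i = j := by
    intro j h
    apply hs j
    ext i; simp [h i]
  have hc' : ∀ j : Fin n, ¬ ∀ i : Fin n, i ∈ G ↔ i ≠ j := by
    intro j h
    apply hc j
    ext i; simp [h i]
  have e1 : G.Nonempty := by
    by_contra h
    rw [Finset.not_nonempty_iff_eq_empty] at h
    exact hch' 0 (by omega) (by simp [h])
  have e2 : Gᶜ.Nonempty := by
    by_contra h
    rw [Finset.not_nonempty_iff_eq_empty, Finset.compl_eq_empty_iff] at h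
    exact hch' n (by omega) (by simp [h])
  obtain ⟨x, hx, hxm⟩ : ∃ x, x ∈ G ∧ ∀ i ∈ G, i ≤ x :=
    ⟨G.max' e1, G.max'_mem e1, fun i hi => G.le_max' i hi⟩
  obtain ⟨z, hz, hzm⟩ : ∃ z, z ∉ G ∧ ∀ i, i ∉ G → z ≤ i :=
    ⟨Gᶜ.min' e2, by simpa using Gᶜ.min'_mem e2, fun i hi => Gᶜ.min'_le i (by simpa using hi)⟩
  have hzx : z < x := by
    by_contra h
    have hne : z ≠ x := by rintro rfl; exact hz hx
    apply hch' z (by omega)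
    intro i
    constructor
    · intro hi
      have := hxm i hi
      have : x < z := lt_of_le_of_ne (not_lt.1 h) hne.symm
      omega
    · intro hi
      by_contra h'
      have := hzm i h'
      omega
  have hx2 : 2 ≤ (x : ℕ) := by
    by_contra h
    have hz0 : (z : ℕ) = 0 := by omega
    apply hs' x
    intro i
    constructor
    · intro hi
      have h1 := hxm i hi
      have : i ≠ z := by rintro rfl; exact hz hi
      omega
    · rintro rfl; exact hx
  have hz3 : (z : ℕ) + 3 ≤ n := by
    by_contra h
    apply hc' z
    intro i
    constructor
    · rintro hi rfl; exact hz hi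
    · intro hi
      by_contra h'
      have h1 := hzm i h'
      have : i ≠ x := by rintro rfl; exact h' hx
      omega
  have hn4 : 4 ≤ n := by
    by_contra h
    have h3 : n = 3 := by omega
    subst h3
    by_cases h1 : (1 : Fin 3) ∈ G
    · apply hc' z
      intro i
      constructor
      · rintro hi rfl; exact hz hi
      · intro hi
        have : i = 1 ∨ i = x := by omega
        rcases this with rfl | rfl <;> assumption
    · apply hs' x
      intro i
      constructor
      · intro hi
        have : i ≠ z := by rintro rfl; exact hz hi
        have : i ≠ 1 := by rintro rfl; exact h1 hi
        omega
      · rintro rfl; exact hx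
  obtain ⟨j, hj1, hj2, hj3, hj4⟩ : ∃ j, 2 ≤ j ∧ j + 2 ≤ n ∧ (z : ℕ) < j ∧ j ≤ (x : ℕ) :=
    ⟨max (z + 1) 2, by omega, by omega, by omega, by omega⟩
  refine copy_mk (A := {x}) (B := G) (C := Finset.univ \ {z}) (D := {z})
    (E := Finset.univ.filter (fun i : Fin n => (i : ℕ) < j)) (H := Finset.univ \ {x})
    ?_ ?_ ?_ ?_ ?_ ?_ ?_ ?_ ?_ ?_ ?_ ?_
  · exact Finset.mem_insert_of_mem ((mem_csc _).2 (Or.inr (Or.inl ⟨x, rfl⟩)))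
  · exact Finset.mem_insert_self _ _
  · exact Finset.mem_insert_of_mem ((mem_csc _).2 (Or.inr (Or.inr ⟨z, rfl⟩)))
  · exact Finset.mem_insert_of_mem ((mem_csc _).2 (Or.inr (Or.inl ⟨z, rfl⟩)))
  · exact Finset.mem_insert_of_mem ((mem_csc _).2 (Or.inl ⟨j, by omega, rfl⟩))
  · exact Finset.mem_insert_of_mem ((mem_csc _).2 (Or.inr (Or.inr ⟨x, rfl⟩)))
  · exact Finset.ssubset_iff_subset_ne.2 ⟨by simpa using hx, hs x⟩
  · refine Finset.ssubset_iff_subset_ne.2 ⟨?_, (hc z).symm⟩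
    intro i hi
    have : i ≠ z := by rintro rfl; exact hz hi
    simp [this]
  · refine Finset.ssubset_iff_subset_ne.2 ⟨by simpa using hj3, ?_⟩
    intro h
    have a0 : (⟨0, by omega⟩ : Fin n) ∈ ({z} : Finset (Fin n)) := by
      rw [h]; simp; omega
    have a1 : (⟨1, by omega⟩ : Fin n) ∈ ({z} : Finset (Fin n)) := by
      rw [h]; simp; omega
    rw [Finset.mem_singleton] at a0 a1
    have := a0.trans a1.symm
    simp at this
  · refine Finset.ssubset_iff_subset_ne.2 ⟨?_, ?_⟩
    · intro i hi
      have : (i : ℕ) < j := by simpa using hi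
      have : i ≠ x := by rintro rfl; omega
      simp [this]
    · intro h
      have a : ∀ i : Fin n, (i : ℕ) < j ↔ i ≠ x := by
        intro i
        have := Finset.ext_iff.1 h i
        simpa using this
      have a0 := a ⟨n - 1, by omega⟩
      have a1 := a ⟨n - 2, by omega⟩
      simp only [ne_eq, Fin.ext_iff] at a0 a1
      omega
  · simp
  · simp

theorem csc_card (n : ℕ) (hn : 3 ≤ n) : (chainSingletonsCosingletons n).card ≤ 3 * n - 1 := by
  have hsub : chainSingletonsCosingletons n ⊆
      fullChain n ∪ ((Finset.univ.erase (⟨0, by omega⟩ : Fin n)).image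
        (fun i : Fin n => ({i} : Finset (Fin n)))
      ∪ (Finset.univ.erase (⟨n - 1, by omega⟩ : Fin n)).image
        (fun i : Fin n => (Finset.univ \ {i} : Finset (Fin n)))) := by
    intro G hG
    rw [mem_csc] at hG
    simp only [Finset.mem_union, fullChain, Finset.mem_image, Finset.mem_range, Finset.mem_erase,
      Finset.mem_univ, and_true]
    rcases hG with h | ⟨i, rfl⟩ | ⟨i, rfl⟩
    · exact Or.inl h
    · by_cases hi : i = ⟨0, by omega⟩
      · left
        refine ⟨1, by omega, ?_⟩
        ext w; subst hi; simp [Fin.ext_iff]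
      · exact Or.inr (Or.inl ⟨i, hi, rfl⟩)
    · by_cases hi : i = ⟨n - 1, by omega⟩
      · left
        refine ⟨n - 1, by omega, ?_⟩
        ext w; subst hi; simp [Fin.ext_iff]; omega
      · exact Or.inr (Or.inr ⟨i, hi, rfl⟩)
  have h1 : (fullChain n).card ≤ n + 1 := Finset.card_image_le.trans (by simp)
  have h2 : ∀ (a : Fin n) (g : Fin n → Finset (Fin n)),
      ((Finset.univ.erase a).image g).card ≤ n - 1 := fun a g =>
    Finset.card_image_le.trans (by simp)
  refine (Finset.card_le_card hsub).trans ((Finset.card_union_le _ _).trans ?_)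
  refine (Nat.add_le_add h1 ((Finset.card_union_le _ _).trans
    (Nat.add_le_add (h2 _ _) (h2 _ _)))).trans ?_
  omega

/-- For `n ≥ 3` the family consisting of a full chain, all singletons and all
co-singletons is induced `2C₃`-saturating; in particular
`sat*(n, 2C₃) ≤ 3n - 1`. -/
theorem satStar_twoC3_le (n : ℕ) (hn : 3 ≤ n) :
    IndSaturating TwoC3 (chainSingletonsCosingletons n) ∧
    satStar n TwoC3 ≤ 3 * n - 1 := by
  have h : IndSaturating TwoC3 (chainSingletonsCosingletons n) :=
    ⟨csc_free n, fun G hG => csc_sat n hn G hG⟩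
  have h' : satStar n TwoC3 ≤ (chainSingletonsCosingletons n).card :=
    Nat.sInf_le ⟨_, h, rfl⟩
  exact ⟨h, h'.trans (csc_card n hn)⟩
end

section
/- For every integer n ≥ 3, sat*(n, ◊′) ≤ 2n, where ◊′ is the 5-element poset with elements A, B, B′, C, C′ and order generated by A < B < C, A < B′, B′ < C, B′ < C′ (so B and B′ are incomparable, C and C′ are incomparable, and B and C′ are incomparable). Moreover, the family ℱ = {∅} ∪ {[j] : 1 ≤ j ≤ n} ∪ {{j} : 1 ≤ j ≤ n} (a full chain together with all singletons) is an induced ◊′-saturating family in 2^[n]. -/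
/-- The underlying type of the poset `◊′` on five elements
`A = 0`, `B = 1`, `B′ = 2`, `C = 3`, `C′ = 4`. -/
def DiamondPrime : Type := Fin 5

/-- The order of `◊′`, generated by `A < B < C`, `A < B′`, `B′ < C`, `B′ < C′`:
so `B, B′` are incomparable, `C, C′` are incomparable and `B, C′` are
incomparable. -/
def diamondPrimeLE : Fin 5 → Fin 5 → Prop := fun x y =>
  x = y ∨ (x = 0 ∧ y ≠ 0) ∨ (x = 1 ∧ y = 3) ∨ (x = 2 ∧ (y = 3 ∨ y = 4))

instance : DecidableRel diamondPrimeLE := fun x y => by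
  unfold diamondPrimeLE; infer_instance

lemma diamondPrimeLE_refl : ∀ x, diamondPrimeLE x x := by decide

lemma diamondPrimeLE_trans :
    ∀ x y z, diamondPrimeLE x y → diamondPrimeLE y z → diamondPrimeLE x z := by decide

lemma diamondPrimeLE_antisymm :
    ∀ x y, diamondPrimeLE x y → diamondPrimeLE y x → x = y := by decide

instance : PartialOrder DiamondPrime where
  le := diamondPrimeLE
  le_refl := diamondPrimeLE_refl
  le_trans := diamondPrimeLE_trans
  le_antisymm := diamondPrimeLE_antisymm

/-- A full chain together with all singletons. -/
def chainAllSingletons (n : ℕ) : Finset (Finset (Fin n)) :=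
  fullChain n ∪ Finset.univ.image (fun i : Fin n => ({i} : Finset (Fin n)))

lemma mem_cas {n : ℕ} (G : Finset (Fin n)) : G ∈ chainAllSingletons n ↔
    (∃ j, j < n + 1 ∧ Finset.univ.filter (fun i : Fin n => (i : ℕ) < j) = G) ∨
    ∃ i : Fin n, {i} = G := by
  simp [chainAllSingletons, fullChain]

lemma cas_free (n : ℕ) : ¬ ContainsIndCopy DiamondPrime (chainAllSingletons n) := by
  rintro ⟨f, -, hF, hf⟩
  have lt : ∀ p q : Fin 5, diamondPrimeLE p q → ¬ diamondPrimeLE q p → f p ⊂ f q :=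
    fun p q h1 h2 => ⟨(hf p q).1 h1, fun h => h2 ((hf q p).2 h)⟩
  have h02 := Finset.card_lt_card (lt 0 2 (by decide) (by decide))
  have h23 := Finset.card_lt_card (lt 2 3 (by decide) (by decide))
  have h24 := Finset.card_lt_card (lt 2 4 (by decide) (by decide))
  have n34 : ¬ f (3 : Fin 5) ⊆ f (4 : Fin 5) := fun h =>
    absurd ((hf (3 : Fin 5) (4 : Fin 5)).2 h) (show ¬ diamondPrimeLE 3 4 by decide)
  have n43 : ¬ f (4 : Fin 5) ⊆ f (3 : Fin 5) := fun h =>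
    absurd ((hf (4 : Fin 5) (3 : Fin 5)).2 h) (show ¬ diamondPrimeLE 4 3 by decide)
  rcases (mem_cas _).1 (hF (3 : Fin 5)) with ⟨a, -, ha⟩ | ⟨a, ha⟩
  · rcases (mem_cas _).1 (hF (4 : Fin 5)) with ⟨b, -, hb⟩ | ⟨b, hb⟩
    · rw [← ha, ← hb] at n34 n43
      rcases le_total a b with h | h
      · apply n34
        intro i hi
        simp only [Finset.mem_filter, Finset.mem_univ, true_and] at hi ⊢
        omega
      · apply n43
        intro i hi
        simp only [Finset.mem_filter, Finset.mem_univ, true_and] at hi ⊢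
        omega
    · rw [← hb, Finset.card_singleton] at h24
      omega
  · rw [← ha, Finset.card_singleton] at h23
    omega

lemma cas_sat (n : ℕ) (G : Finset (Fin n)) (hG : G ∉ chainAllSingletons n) :
    ContainsIndCopy DiamondPrime (insert G (chainAllSingletons n)) := by
  rw [mem_cas] at hG
  push Not at hG
  obtain ⟨h1, h2⟩ := hG
  have hne : G.Nonempty := by
    rw [Finset.nonempty_iff_ne_empty]
    rintro rfl
    exact h1 0 (by omega) (by simp)
  obtain ⟨m, hm, hmax⟩ : ∃ m ∈ G, ∀ i ∈ G, i ≤ m := ⟨G.max' hne, G.max'_mem hne, fun i hi => G.le_max' i hi⟩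
  obtain ⟨x, hx, hxm⟩ : ∃ x ∈ G, x ≠ m := by
    by_contra hc
    push Not at hc
    apply h2 m
    ext i
    simp only [Finset.mem_singleton]
    exact ⟨fun h => h ▸ hm, hc i⟩
  obtain ⟨k, hk, hkm⟩ : ∃ k, k ∉ G ∧ k < m := by
    by_contra hc
    push Not at hc
    apply h1 (m + 1) (by omega)
    ext i
    simp only [Finset.mem_filter, Finset.mem_univ, true_and]
    constructor
    · intro hi
      by_contra hiG
      have := hc i hiG
      have : i = m := by apply Fin.ext; have := Fin.le_def.1 this; omega
      exact hiG (this ▸ hm)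
    · intro hi
      have := Fin.le_def.1 (hmax i hi)
      omega
  have hxm' : x < m := lt_of_le_of_ne (hmax x hx) hxm
  have hxk : x ≠ k := fun h => hk (h ▸ hx)
  set C : Finset (Fin n) := Finset.univ.filter (fun i : Fin n => (i : ℕ) < m) with hC
  have hmC : ∀ i, i ∈ C ↔ i < m := by intro i; simp [hC]
  have kC := (hmC k).2 hkm
  have xC := (hmC x).2 hxm'
  have mC : m ∉ C := fun h => lt_irrefl _ ((hmC m).1 h)
  have nCG : ¬ C ⊆ G := fun h => hk (h kC)
  have nGC : ¬ G ⊆ C := fun h => mC (h hm)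
  let f : Fin 5 → Finset (Fin n) := ![∅, {k}, {x}, C, G]
  have key : ∀ p q : Fin 5, diamondPrimeLE p q ↔ f p ⊆ f q := by
    have C0 : C ≠ ∅ := Finset.ne_empty_of_mem kC
    have G0 : G ≠ ∅ := Finset.ne_empty_of_mem hx
    have e1 : ∀ y, ¬ C ⊆ {y} := by
      intro y h
      have a := Finset.mem_singleton.1 (h kC)
      have b := Finset.mem_singleton.1 (h xC)
      exact hxk (b.trans a.symm)
    have e2 : ∀ y, ¬ G ⊆ {y} := by
      intro y h
      have a := Finset.mem_singleton.1 (h hm)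
      have b := Finset.mem_singleton.1 (h hx)
      exact hxm (b.trans a.symm)
    clear_value C
    intro p q
    fin_cases p <;> fin_cases q <;>
      simp [f, diamondPrimeLE, hk, hx, kC, xC, nCG, nGC, hxk, hxk.symm, e1, e2, C0, G0,
        -Finset.subset_singleton_iff]
  refine ⟨f, ?_, ?_, key⟩
  · intro p q h
    exact diamondPrimeLE_antisymm p q ((key p q).2 (by rw [show f p = f q from h]))
      ((key q p).2 (by rw [show f p = f q from h]))
  · intro p
    change Fin 5 at p
    rw [Finset.mem_insert, mem_cas]
    fin_cases p
    · exact Or.inr (Or.inl ⟨0, by omega, by simp [f]⟩)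
    · exact Or.inr (Or.inr ⟨k, rfl⟩)
    · exact Or.inr (Or.inr ⟨x, rfl⟩)
    · exact Or.inr (Or.inl ⟨m, by omega, rfl⟩)
    · exact Or.inl rfl

lemma cas_card (n : ℕ) (hn : 3 ≤ n) : (chainAllSingletons n).card ≤ 2 * n := by
  let z : Fin n := ⟨0, by omega⟩
  have hsub : chainAllSingletons n ⊆ fullChain n ∪
      (Finset.univ.erase z).image (fun i : Fin n => ({i} : Finset (Fin n))) := by
    intro G hG
    rw [Finset.mem_union]
    rcases (mem_cas _).1 hG with ⟨j, hj, rfl⟩ | ⟨i, rfl⟩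
    · left
      exact Finset.mem_image.2 ⟨j, Finset.mem_range.2 hj, rfl⟩
    · by_cases hi : i = z
      · left
        refine Finset.mem_image.2 ⟨1, Finset.mem_range.2 (by omega), ?_⟩
        ext y
        simp [hi, z, Fin.ext_iff]
      · right
        exact Finset.mem_image.2 ⟨i, by simp [hi], rfl⟩
  have c1 : (fullChain n).card ≤ n + 1 := by
    simpa [fullChain] using (Finset.card_image_le (s := Finset.range (n + 1))
      (f := fun j => Finset.univ.filter (fun i : Fin n => (i : ℕ) < j)))
  have c2 : ((Finset.univ.erase z).image (fun i : Fin n => ({i} : Finset (Fin n)))).card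
      ≤ n - 1 := by
    refine Finset.card_image_le.trans ?_
    simp
  have := (Finset.card_le_card hsub).trans (Finset.card_union_le _ _)
  omega

/-- For `n ≥ 3` the family consisting of a full chain and all singletons is
induced `◊′`-saturating; in particular `sat*(n, ◊′) ≤ 2n`. -/
theorem satStar_diamondPrime_le (n : ℕ) (hn : 3 ≤ n) :
    IndSaturating DiamondPrime (chainAllSingletons n) ∧
    satStar n DiamondPrime ≤ 2 * n := by
  have h : IndSaturating DiamondPrime (chainAllSingletons n) := ⟨cas_free n, cas_sat n⟩
  refine ⟨h, le_trans ?_ (cas_card n hn)⟩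
  exact Nat.sInf_le ⟨_, h, rfl⟩
end

section
/- For every integer n ≥ 4, sat*(n, 3C₂) ≤ 14, where 3C₂ is the disjoint union of three pairwise incomparable 2-element chains. -/
/-- `3C₂`, the disjoint union of three pairwise incomparable `2`-element chains. -/
abbrev ThreeC2 : Type := Fin 2 ⊕ (Fin 2 ⊕ Fin 2)

namespace SatThree

def le (a b : Fin 16) : Bool := (a.val &&& b.val) == a.val

def bt (m : Fin 16) (j : ℕ) : Bool := m.val.testBit j

def okQ (m : Fin 16) : Bool := m.val != 3 && m.val != 12

def enc (a b c d : Bool) : Fin 16 :=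
  match a, b, c, d with
  | false, false, false, false => 0
  | true, false, false, false => 1
  | false, true, false, false => 2
  | true, true, false, false => 3
  | false, false, true, false => 4
  | true, false, true, false => 5
  | false, true, true, false => 6
  | true, true, true, false => 7
  | false, false, false, true => 8
  | true, false, false, true => 9
  | false, true, false, true => 10
  | true, true, false, true => 11
  | false, false, true, true => 12
  | true, false, true, true => 13
  | false, true, true, true => 14
  | true, true, true, true => 15

theorem le_enc : ∀ (m : Fin 16) (a b c d : Bool), le m (enc a b c d) = true ↔
    ((bt m 0 = true → a = true) ∧ (bt m 1 = true → b = true) ∧ (bt m 2 = true → c = true) ∧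
      (bt m 3 = true → d = true)) := by decide +kernel

theorem enc_le : ∀ (m : Fin 16) (a b c d : Bool), le (enc a b c d) m = true ↔
    ((a = true → bt m 0 = true) ∧ (b = true → bt m 1 = true) ∧ (c = true → bt m 2 = true) ∧
      (d = true → bt m 3 = true)) := by decide +kernel

theorem le_iff : ∀ (m k : Fin 16), le m k = true ↔
    ((bt m 0 = true → bt k 0 = true) ∧ (bt m 1 = true → bt k 1 = true) ∧
      (bt m 2 = true → bt k 2 = true) ∧ (bt m 3 = true → bt k 3 = true)) := by decide +kernel

theorem no_copy : ∀ x : Fin 16, okQ x = true → ∀ x' : Fin 16, okQ x' = true →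
    le x x' = true → le x' x = false →
    ∀ y : Fin 16, okQ y = true → le y x' = false → ∀ y' : Fin 16, okQ y' = true →
    le y y' = true → le y' y = false → le x y' = false →
    ∀ z : Fin 16, okQ z = true → le z x' = false → le z y' = false →
    ∀ z' : Fin 16, okQ z' = true →
    le z z' = true → le z' z = false → le x z' = false → le y z' = false → False := by
  decide +kernel

set_option synthInstance.maxHeartbeats 400000 in
set_option synthInstance.maxSize 4000 in
theorem ex_copy : ∀ a b c d e : Bool, (d = true → e = true) →
    (d = e → okQ (enc a b c d) = false) →
    ∃ z : Fin 16, okQ z = true ∧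
      ((le (enc a b c e) z = true ∧ le z (enc a b c d) = false ∧
        ∃ x, okQ x = true ∧ le x z = false ∧ ∃ x', okQ x' = true ∧ le x x' = true ∧
          le x' x = false ∧ le (enc a b c e) x' = false ∧
        ∃ y, okQ y = true ∧ le y z = false ∧ le y x' = false ∧
        ∃ y', okQ y' = true ∧ le y y' = true ∧
          le y' y = false ∧ le (enc a b c e) y' = false ∧ le x y' = false) ∨
       (le z (enc a b c d) = true ∧ le (enc a b c e) z = false ∧
        ∃ x, okQ x = true ∧ le x (enc a b c d) = false ∧ ∃ x', okQ x' = true ∧ le x x' = true ∧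
          le x' x = false ∧ le z x' = false ∧
        ∃ y, okQ y = true ∧ le y (enc a b c d) = false ∧ le y x' = false ∧
        ∃ y', okQ y' = true ∧ le y y' = true ∧
          le y' y = false ∧ le z y' = false ∧ le x y' = false)) := by
  decide +kernel

theorem copy_of {n : ℕ} {F : Finset (Finset (Fin n))} (A A' B B' C C' : Finset (Fin n))
    (hA : A ∈ F) (hA' : A' ∈ F) (hB : B ∈ F) (hB' : B' ∈ F) (hC : C ∈ F) (hC' : C' ∈ F)
    (a : A ⊆ A') (a' : ¬ A' ⊆ A) (b : B ⊆ B') (b' : ¬ B' ⊆ B) (c : C ⊆ C') (c' : ¬ C' ⊆ C)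
    (ab : ¬ A ⊆ B') (ac : ¬ A ⊆ C') (ba : ¬ B ⊆ A') (bc : ¬ B ⊆ C') (ca : ¬ C ⊆ A')
    (cb : ¬ C ⊆ B') : ContainsIndCopy ThreeC2 F := by
  have key : ∀ {X X' Y Y' : Finset (Fin n)}, X ⊆ X' → Y ⊆ Y' → ¬ X ⊆ Y' →
      ¬ X ⊆ Y ∧ ¬ X' ⊆ Y ∧ ¬ X' ⊆ Y' := fun h1 h2 h3 =>
    ⟨fun h => h3 (h.trans h2), fun h => h3 (h1.trans (h.trans h2)), fun h => h3 (h1.trans h)⟩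
  obtain ⟨ab1, ab2, ab3⟩ := key a b ab
  obtain ⟨ac1, ac2, ac3⟩ := key a c ac
  obtain ⟨ba1, ba2, ba3⟩ := key b a ba
  obtain ⟨bc1, bc2, bc3⟩ := key b c bc
  obtain ⟨ca1, ca2, ca3⟩ := key c a ca
  obtain ⟨cb1, cb2, cb3⟩ := key c b cb
  let f : ThreeC2 → Finset (Fin n) :=
    Sum.elim ![A, A'] (Sum.elim ![B, B'] ![C, C'])
  have hf : ∀ p q : ThreeC2, p ≤ q ↔ f p ⊆ f q := by
    rintro (p | p | p) (q | q | q) <;> fin_cases p <;> fin_cases q <;> simp [f, *]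
  refine ⟨f, ?_, ?_, hf⟩
  · intro p q h
    exact le_antisymm ((hf p q).2 h.subset) ((hf q p).2 h.symm.subset)
  · rintro (p | p | p) <;> fin_cases p <;> simp [f, *]

def E (n : ℕ) (m : Fin 16) : Finset (Fin n) :=
  Finset.univ.filter (fun i => bt m (min i.val 3) = true)

theorem mem_E {n : ℕ} (m : Fin 16) (i : Fin n) : i ∈ E n m ↔ bt m (min i.val 3) = true := by
  simp [E]

theorem forall_split {n : ℕ} (hn : 4 ≤ n) (P : Fin n → Prop) :
    (∀ i, P i) ↔ (P ⟨0, by omega⟩ ∧ P ⟨1, by omega⟩ ∧ P ⟨2, by omega⟩ ∧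
      ∀ i : Fin n, 3 ≤ i.val → P i) := by
  constructor
  · intro h
    exact ⟨h _, h _, h _, fun i _ => h i⟩
  · rintro ⟨h0, h1, h2, h3⟩ ⟨i, hi⟩
    rcases Nat.lt_or_ge i 3 with h | h
    · interval_cases i <;> assumption
    · exact h3 _ h

theorem E_sub {n : ℕ} (hn : 4 ≤ n) (m : Fin 16) (G : Finset (Fin n)) : E n m ⊆ G ↔
    ((bt m 0 = true → (⟨0, by omega⟩ : Fin n) ∈ G) ∧ (bt m 1 = true → (⟨1, by omega⟩ : Fin n) ∈ G) ∧
     (bt m 2 = true → (⟨2, by omega⟩ : Fin n) ∈ G) ∧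
     (bt m 3 = true → ∀ i : Fin n, 3 ≤ i.val → i ∈ G)) := by
  rw [Finset.subset_iff, forall_split hn]
  simp only [mem_E]
  refine and_congr Iff.rfl (and_congr Iff.rfl (and_congr Iff.rfl ?_))
  constructor
  · intro h hm i hi
    exact h i hi (by rwa [min_eq_right hi])
  · intro h i hi hm
    rw [min_eq_right hi] at hm
    exact h hm i hi

theorem sub_E {n : ℕ} (hn : 4 ≤ n) (m : Fin 16) (G : Finset (Fin n)) : G ⊆ E n m ↔
    (((⟨0, by omega⟩ : Fin n) ∈ G → bt m 0 = true) ∧ ((⟨1, by omega⟩ : Fin n) ∈ G → bt m 1 = true) ∧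
     ((⟨2, by omega⟩ : Fin n) ∈ G → bt m 2 = true) ∧
     ((∃ i : Fin n, 3 ≤ i.val ∧ i ∈ G) → bt m 3 = true)) := by
  rw [Finset.subset_iff, forall_split hn]
  simp only [mem_E]
  refine and_congr Iff.rfl (and_congr Iff.rfl (and_congr Iff.rfl ?_))
  constructor
  · rintro h ⟨i, hi, hm⟩
    have := h i hi hm
    rwa [min_eq_right hi] at this
  · intro h i hi hm
    rw [min_eq_right hi]
    exact h ⟨i, hi, hm⟩

theorem E_E {n : ℕ} (hn : 4 ≤ n) (m k : Fin 16) : E n m ⊆ E n k ↔ le m k = true := by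
  rw [E_sub hn, le_iff]
  simp only [mem_E]
  refine and_congr Iff.rfl (and_congr Iff.rfl (and_congr Iff.rfl ?_))
  constructor
  · intro h hm
    exact h hm ⟨3, by omega⟩ le_rfl
  · intro h hm i hi
    rw [min_eq_right hi]
    exact h hm

theorem nE_E {n : ℕ} (hn : 4 ≤ n) (m k : Fin 16) : ¬ E n m ⊆ E n k ↔ le m k = false := by
  rw [E_E hn]; simp

def Fam (n : ℕ) : Finset (Finset (Fin n)) :=
  (Finset.univ.filter (fun m : Fin 16 => okQ m = true)).image (E n)

theorem mem_Fam {n : ℕ} (G : Finset (Fin n)) : G ∈ Fam n ↔ ∃ m, okQ m = true ∧ E n m = G := by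
  simp [Fam]

theorem E_mem {n : ℕ} {m : Fin 16} (h : okQ m = true) (G : Finset (Fin n)) :
    E n m ∈ insert G (Fam n) :=
  Finset.mem_insert_of_mem ((mem_Fam _).2 ⟨m, h, rfl⟩)

theorem free {n : ℕ} (hn : 4 ≤ n) : ¬ ContainsIndCopy ThreeC2 (Fam n) := by
  rintro ⟨f, -, hF, hf⟩
  choose g hg hgE using fun p => (mem_Fam _).1 (hF p)
  have H : ∀ p q, p ≤ q ↔ le (g p) (g q) = true := by
    intro p q
    rw [hf, ← hgE p, ← hgE q, E_E hn]
  have T : ∀ p q, p ≤ q → le (g p) (g q) = true := fun p q h => (H p q).1 h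
  have N : ∀ p q, ¬ p ≤ q → le (g p) (g q) = false := fun p q h => by
    rw [H] at h; simpa using h
  exact no_copy (g (.inl 0)) (hg _) (g (.inl 1)) (hg _) (T _ _ (by simp)) (N _ _ (by simp))
    (g (.inr (.inl 0))) (hg _) (N _ _ (by simp)) (g (.inr (.inl 1))) (hg _)
    (T _ _ (by simp)) (N _ _ (by simp)) (N _ _ (by simp))
    (g (.inr (.inr 0))) (hg _) (N _ _ (by simp)) (N _ _ (by simp)) (g (.inr (.inr 1))) (hg _)
    (T _ _ (by simp)) (N _ _ (by simp)) (N _ _ (by simp)) (N _ _ (by simp))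

open Classical in
theorem sat {n : ℕ} (hn : 4 ≤ n) (G : Finset (Fin n)) (hG : G ∉ Fam n) :
    ContainsIndCopy ThreeC2 (insert G (Fam n)) := by
  obtain ⟨a, ha⟩ : ∃ a : Bool, a = true ↔ (⟨0, by omega⟩ : Fin n) ∈ G := ⟨decide _, decide_eq_true_iff⟩
  obtain ⟨b, hb⟩ : ∃ a : Bool, a = true ↔ (⟨1, by omega⟩ : Fin n) ∈ G := ⟨decide _, decide_eq_true_iff⟩
  obtain ⟨c, hc⟩ : ∃ a : Bool, a = true ↔ (⟨2, by omega⟩ : Fin n) ∈ G := ⟨decide _, decide_eq_true_iff⟩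
  obtain ⟨d, hd⟩ : ∃ a : Bool, a = true ↔ ∀ i : Fin n, 3 ≤ i.val → i ∈ G :=
    ⟨decide _, decide_eq_true_iff⟩
  obtain ⟨e, he⟩ : ∃ a : Bool, a = true ↔ ∃ i : Fin n, 3 ≤ i.val ∧ i ∈ G :=
    ⟨decide _, decide_eq_true_iff⟩
  have lo : ∀ m, E n m ⊆ G ↔ le m (enc a b c d) = true := by
    intro m; rw [E_sub hn, le_enc, ha, hb, hc, hd]
  have up : ∀ m, G ⊆ E n m ↔ le (enc a b c e) m = true := by
    intro m; rw [sub_E hn, enc_le, ha, hb, hc, he]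
  have nlo : ∀ m, ¬ E n m ⊆ G ↔ le m (enc a b c d) = false := by
    intro m; rw [lo]; simp
  have nup : ∀ m, ¬ G ⊆ E n m ↔ le (enc a b c e) m = false := by
    intro m; rw [up]; simp
  have hde : d = true → e = true := by
    rw [hd, he]
    intro h
    exact ⟨⟨3, by omega⟩, le_rfl, h _ le_rfl⟩
  have hll : ∀ m, le m m = true := by decide
  have hq : d = e → okQ (enc a b c d) = false := by
    intro h
    by_contra hk
    apply hG
    refine (mem_Fam _).2 ⟨enc a b c d, by simpa using hk, ?_⟩
    exact Finset.Subset.antisymm ((lo _).2 (hll _)) ((up _).2 (by rw [h]; exact hll _))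
  have hGm : G ∈ insert G (Fam n) := Finset.mem_insert_self _ _
  obtain ⟨z, hz, ⟨h1, h2, x, hx, h3, x', hx', h4, h5, h6, y, hy, h7, h8, y', hy', h9, h10, h11, h12⟩ |
    ⟨h1, h2, x, hx, h3, x', hx', h4, h5, h6, y, hy, h7, h8, y', hy', h9, h10, h11, h12⟩⟩ :=
    ex_copy a b c d e hde hq
  · exact copy_of G (E n z) (E n x) (E n x') (E n y) (E n y') hGm (E_mem hz _) (E_mem hx _)
      (E_mem hx' _) (E_mem hy _) (E_mem hy' _) ((up _).2 h1) ((nlo _).2 h2)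
      ((E_E hn _ _).2 h4) ((nE_E hn _ _).2 h5) ((E_E hn _ _).2 h9) ((nE_E hn _ _).2 h10)
      ((nup _).2 h6) ((nup _).2 h11) ((nE_E hn _ _).2 h3) ((nE_E hn _ _).2 h12)
      ((nE_E hn _ _).2 h7) ((nE_E hn _ _).2 h8)
  · exact copy_of (E n z) G (E n x) (E n x') (E n y) (E n y') (E_mem hz _) hGm (E_mem hx _)
      (E_mem hx' _) (E_mem hy _) (E_mem hy' _) ((lo _).2 h1) ((nup _).2 h2)
      ((E_E hn _ _).2 h4) ((nE_E hn _ _).2 h5) ((E_E hn _ _).2 h9) ((nE_E hn _ _).2 h10)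
      ((nE_E hn _ _).2 h6) ((nE_E hn _ _).2 h11) ((nlo _).2 h3) ((nE_E hn _ _).2 h12)
      ((nlo _).2 h7) ((nE_E hn _ _).2 h8)

end SatThree

/-- For every `n ≥ 4`, `sat*(n, 3C₂) ≤ 14`. -/
theorem satStar_threeC2_le (n : ℕ) (hn : 4 ≤ n) :
    satStar n ThreeC2 ≤ 14 := by
  refine le_trans (Nat.sInf_le ⟨SatThree.Fam n, ⟨SatThree.free hn, fun G hG => ?_⟩, rfl⟩) ?_
  · convert SatThree.sat hn G hG
  · refine le_trans Finset.card_image_le ?_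
    decide
end
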